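/- Let F be a differential field whose field of constants K is algebraically closed. If M ∈ F^{n×n} is nonderogatory and M M' = M' M, then M is K-triangularizable. -/

import Mathlib

def IsDeriv {F : Type*} [Field F] (d : F → F) : Prop :=
  (∀ a b, d (a + b) = d a + d b) ∧ (∀ a b, d (a * b) = d a * b + a * d b)

namespace IsDeriv

variable {F : Type*} [Field F] {d : F → F}

theorem map_zero (hd : IsDeriv d) : d 0 = 0 := by
  simpa using hd.1 0 0

theorem map_one (hd : IsDeriv d) : d 1 = 0 := by
  simpa using hd.2 1 1

theorem map_sum (hd : IsDeriv d) {ι : Type*} (s : Finset ι) (f : ι → F) :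
    d (∑ i ∈ s, f i) = ∑ i ∈ s, d (f i) :=
  _root_.map_sum (⟨⟨d, hd.map_zero⟩, hd.1⟩ : F →+ F) f s

theorem matrix_map_mul (hd : IsDeriv d) {n : Type*} [Fintype n] (A B : Matrix n n F) :
    (A * B).map d = A.map d * B + A * B.map d := by
  ext i j
  simp [Matrix.mul_apply, hd.map_sum, hd.2, Finset.sum_add_distrib]

/-- If the entrywise derivative of `M` lies in `F[M]`, then `F[M]` is closed under it. -/
theorem map_mem_adjoin (hd : IsDeriv d) {n : Type*} [Fintype n] [DecidableEq n]
    {M : Matrix n n F} (hM : M.map d ∈ Algebra.adjoin F {M}) {B : Matrix n n F}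
    (hB : B ∈ Algebra.adjoin F {M}) : B.map d ∈ Algebra.adjoin F {M} := by
  induction hB using Algebra.adjoin_induction with
  | mem x hx => rwa [Set.mem_singleton_iff.mp hx]
  | algebraMap r =>
    convert Subalgebra.algebraMap_mem (Algebra.adjoin F {M}) (d r) using 1
    ext i j
    by_cases h : i = j <;> simp [Matrix.algebraMap_matrix_apply, h, hd.map_zero]
  | add x y _ _ hx hy =>
    rw [Matrix.map_add d hd.1]
    exact add_mem hx hy
  | mul x y hx' hy' hx hy =>
    rw [hd.matrix_map_mul]
    exact add_mem (mul_mem hx hy') (mul_mem hx' hy)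

/-- A space of matrices closed under the entrywise derivative is spanned by constant matrices. -/
theorem mem_span_constants (hd : IsDeriv d) {m n : Type*} [Fintype m] [Fintype n]
    {V : Submodule F (Matrix m n F)} (hV : ∀ B ∈ V, B.map d ∈ V) {B : Matrix m n F}
    (hB : B ∈ V) : B ∈ Submodule.span F {C | C ∈ V ∧ C.map d = 0} := by
  classical
  let supp (A : Matrix m n F) : Finset (m × n) := {p | A p.1 p.2 ≠ 0}
  have mem_supp (A p) : p ∈ supp A ↔ A p.1 p.2 ≠ 0 := by simp [supp]
  have supp_nonempty {A} (hA : A ≠ 0) : (supp A).Nonempty := by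
    by_contra h
    refine hA (Matrix.ext fun i j => ?_)
    by_contra h'
    exact h ⟨(i, j), (mem_supp _ _).2 h'⟩
  induction hk : (supp B).card using Nat.strong_induction_on generalizing B with
  | _ k ih =>
  subst hk
  by_cases hB0 : B = 0
  · rw [hB0]
    exact zero_mem _
  obtain ⟨A, ⟨hAV, hA0, hAB⟩, hmin⟩ := exists_minimalFor_of_wellFoundedLT
    (fun A => A ∈ V ∧ A ≠ 0 ∧ supp A ⊆ supp B) (fun A => (supp A).card)
    ⟨B, hB, hB0, subset_rfl⟩
  obtain ⟨p, hp⟩ := supp_nonempty hA0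
  rw [mem_supp] at hp
  set C := (A p.1 p.2)⁻¹ • A with hC
  have hCV : C ∈ V := V.smul_mem _ hAV
  have hCp : C p.1 p.2 = 1 := by simp [hC, hp]
  have hCA : supp C = supp A := by
    ext q
    simp [mem_supp, hC, hp]
  have hC' : C.map d = 0 := by
    by_contra h0
    have hss : supp (C.map d) ⊆ (supp A).erase p := by
      intro q hq
      rw [mem_supp, Matrix.map_apply] at hq
      rw [← hCA, Finset.mem_erase, mem_supp]
      refine ⟨fun h => hq ?_, fun h => hq ?_⟩
      · rw [h, hCp, hd.map_one]
      · rw [h, hd.map_zero]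
    have hle := hmin (j := C.map d) ⟨hV _ hCV, h0, (hss.trans (Finset.erase_subset _ _)).trans hAB⟩
      (Finset.card_le_card (hss.trans (Finset.erase_subset _ _)))
    have := Finset.card_erase_lt_of_mem ((mem_supp A p).2 hp)
    have := Finset.card_le_card hss
    simp only at hle
    omega
  have hCspan : C ∈ Submodule.span F {C | C ∈ V ∧ C.map d = 0} :=
    Submodule.subset_span ⟨hCV, hC'⟩
  have hpB : p ∈ supp B := hAB ((mem_supp A p).2 hp)
  have hss : supp (B - B p.1 p.2 • C) ⊆ (supp B).erase p := by
    intro q hq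
    rw [mem_supp, Matrix.sub_apply, Matrix.smul_apply] at hq
    rw [Finset.mem_erase]
    refine ⟨fun h => hq (by rw [h, hCp]; simp), ?_⟩
    by_contra h
    have hqC : q ∉ supp C := fun h' => h (hAB (hCA ▸ h'))
    rw [mem_supp, not_not] at h hqC
    exact hq (by simp [h, hqC])
  have := ih _ ((Finset.card_le_card hss).trans_lt (Finset.card_erase_lt_of_mem hpB))
    (V.sub_mem hB (V.smul_mem _ hCV)) rfl
  simpa using add_mem this (Submodule.smul_mem _ (B p.1 p.2) hCspan)

end IsDeriv

open Polynomial Matrix in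
/-- The centralizer of a nonderogatory matrix `M` is `F[M]`. -/
theorem Matrix.mem_adjoin_of_minpoly_eq_charpoly {F n : Type*} [Field F] [Fintype n]
    [DecidableEq n] {M N : Matrix n n F} (hnd : minpoly F M = M.charpoly) (h : Commute M N) :
    N ∈ Algebra.adjoin F {M} := by
  obtain ⟨v, hv⟩ : ∃ v : n → F, ∀ p : F[X], aeval M p *ᵥ v = 0 → minpoly F M ∣ p := by
    obtain ⟨x, hx⟩ := Module.exists_ker_toSpanSingleton_eq_annihilator (R := F[X])
      (M := Module.AEval' M.toLin')
    refine ⟨(Module.AEval'.of M.toLin').symm x, fun p hp => ?_⟩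
    have hp' : p • x = 0 := by
      apply (Module.AEval'.of M.toLin').symm.injective
      have haeval : aeval M.toLin' p = (aeval M p).toLin' :=
        aeval_algHom_apply Matrix.toLinAlgEquiv' M p
      rw [Module.AEval.of_symm_smul, haeval, map_zero]
      exact hp
    rw [← Matrix.minpoly_toLin', ← Ideal.mem_span_singleton,
      span_minpoly_eq_annihilator, ← hx]
    exact hp'
  let L : degreeLT F (Fintype.card n) →ₗ[F] n → F :=
    (Matrix.mulVecBilin F F).flip v ∘ₗ (aeval M).toLinearMap ∘ₗ (degreeLT F _).subtype
  have hL (p) : L p = aeval M (p : F[X]) *ᵥ v := rfl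
  have hinj : Function.Injective L := by
    rw [injective_iff_map_eq_zero]
    intro p hp
    have hdvd := hv _ hp
    by_contra h0
    have h0' : (p : F[X]) ≠ 0 := by simpa using h0
    have h1 := degree_le_of_dvd hdvd h0'
    rw [hnd, M.charpoly_degree_eq_dim] at h1
    exact absurd (mem_degreeLT.1 p.2) (not_lt.2 h1)
  have hsurj : Function.Surjective L := by
    refine (LinearMap.injective_iff_surjective_of_finrank_eq_finrank ?_).1 hinj
    rw [(degreeLTEquiv F _).finrank_eq]
    simp
  obtain ⟨p, hp⟩ := hsurj (N *ᵥ v)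
  suffices N = aeval M (p : F[X]) by
    rw [this]
    exact aeval_mem_adjoin_singleton F M
  refine Matrix.toLin'.injective (LinearMap.ext fun w => ?_)
  obtain ⟨q, rfl⟩ := hsurj w
  have hq : Commute (aeval M (q : F[X])) N :=
    (Algebra.commute_of_mem_adjoin_singleton_of_commute
      (aeval_mem_adjoin_singleton F M) h.symm).symm
  rw [Matrix.toLin'_apply, Matrix.toLin'_apply, hL, Matrix.mulVec_mulVec, Matrix.mulVec_mulVec,
    ← hq.eq, ← Matrix.mulVec_mulVec, ← hp, hL, Matrix.mulVec_mulVec, ← map_mul, ← map_mul, mul_comm]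

namespace Module.End

variable {K V : Type*} [Field K] [IsAlgClosed K] [AddCommGroup V] [Module K V]
  [FiniteDimensional K V]

theorem exists_common_eigenvector [Nontrivial V] {S : Set (End K V)}
    (hS : ∀ f ∈ S, ∀ g ∈ S, Commute f g) :
    ∃ v : V, v ≠ 0 ∧ ∀ f ∈ S, ∃ μ : K, f v = μ • v := by
  obtain ⟨p, ⟨hp0, hpS⟩, hmin⟩ := exists_minimal_of_wellFoundedLT
    (fun p : Submodule K V => p ≠ ⊥ ∧ ∀ f ∈ S, ∀ v ∈ p, f v ∈ p)
    ⟨⊤, top_ne_bot, fun _ _ _ _ => trivial⟩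
  obtain ⟨v, hvp, hv0⟩ := p.ne_bot_iff.1 hp0
  refine ⟨v, hv0, fun f hf => ?_⟩
  have : Nontrivial p := Submodule.nontrivial_iff_ne_bot.2 hp0
  obtain ⟨μ, hμ⟩ := Module.End.exists_eigenvalue (LinearMap.restrict f (hpS f hf))
  obtain ⟨w, hw⟩ := hμ.exists_hasEigenvector
  have hle := hmin (y := p ⊓ f.eigenspace μ) ⟨(Submodule.ne_bot_iff _).2 ⟨w, ⟨w.2, ?_⟩, ?_⟩, ?_⟩
    inf_le_left
  · exact ⟨μ, mem_eigenspace_iff.1 (hle hvp).2⟩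
  · exact mem_eigenspace_iff.2 (congrArg Subtype.val hw.apply_eq_smul)
  · simpa using hw.2
  · rintro g hg u ⟨hu, hu'⟩
    exact ⟨hpS g hg u hu, mapsTo_genEigenspace_of_comm (hS f hf g hg) μ 1 hu'⟩

/-- A commuting family of endomorphisms over an algebraically closed field stabilizes a
complete flag. -/
theorem exists_basis_forall_mem_span_Ici {n : ℕ} (hn : Module.finrank K V = n)
    {S : Set (End K V)} (hS : ∀ f ∈ S, ∀ g ∈ S, Commute f g) :
    ∃ b : Basis (Fin n) K V, ∀ f ∈ S, ∀ j, f (b j) ∈ Submodule.span K (b '' Set.Ici j) := by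
  induction n generalizing V with
  | zero => exact ⟨Module.finBasisOfFinrankEq K V hn, fun _ _ j => j.elim0⟩
  | succ n ih =>
    have : Nontrivial V := Module.nontrivial_of_finrank_pos (R := K) (by omega)
    obtain ⟨φ, hφ0, hφ⟩ := exists_common_eigenvector (V := Module.Dual K V)
      (S := (fun f => LinearMap.dualMap f) '' S) (by
        rintro _ ⟨f, hf, rfl⟩ _ ⟨g, hg, rfl⟩
        refine LinearMap.ext fun φ => LinearMap.ext fun v => ?_
        exact congrArg φ (LinearMap.congr_fun (hS g hg f hf) v))
    have hker : ∀ f ∈ S, ∀ v ∈ LinearMap.ker φ, f v ∈ LinearMap.ker φ := by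
      intro f hf v hv
      obtain ⟨μ, hμ⟩ := hφ _ ⟨f, hf, rfl⟩
      rw [LinearMap.mem_ker] at hv ⊢
      simpa [hv] using LinearMap.congr_fun hμ v
    have hrank : Module.finrank K (LinearMap.ker φ) = n := by
      have := Module.Dual.finrank_ker_add_one_of_ne_zero hφ0
      omega
    obtain ⟨b, hb⟩ := ih hrank
      (S := {g | ∃ f, ∃ hf : f ∈ S, g = LinearMap.restrict f (hker f hf)}) (by
        rintro _ ⟨f, hf, rfl⟩ _ ⟨g, hg, rfl⟩
        refine LinearMap.ext fun v => Subtype.ext ?_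
        exact LinearMap.congr_fun (hS f hf g hg) v)
    obtain ⟨y, hy⟩ : ∃ y, φ y ≠ 0 := by
      by_contra! h
      exact hφ0 (LinearMap.ext h)
    let c : Basis (Fin (n + 1)) K V := Basis.mkFinCons y b
      (fun a x hx h => by
        have := congrArg φ h
        simpa [LinearMap.mem_ker.1 hx, hy] using this)
      (fun z => ⟨-(φ z / φ y), by simp [hy]⟩)
    have hc : (c : Fin (n + 1) → V) = Fin.cons y ((↑) ∘ b) := Basis.coe_mkFinCons ..
    refine ⟨c, fun f hf j => ?_⟩
    refine Fin.cases ?_ (fun j => ?_) j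
    · have : Set.Ici (0 : Fin (n + 1)) = Set.univ := Set.Ici_bot
      simp [this, c.span_eq]
    · have := Submodule.mem_map_of_mem (f := (LinearMap.ker φ).subtype) (hb _ ⟨f, hf, rfl⟩ j)
      rw [Submodule.map_span] at this
      have hcj : c j.succ = b j := by simp [hc]
      rw [hcj]
      refine Submodule.span_mono ?_ this
      rintro _ ⟨_, ⟨i, hi, rfl⟩, rfl⟩
      exact ⟨i.succ, by simpa using hi, by simp [hc]⟩

end Module.End

/-- A commuting family of matrices over an algebraically closed field is simultaneously
triangularizable. -/
theorem Matrix.exists_blockTriangular_of_commute {K : Type*} [Field K] [IsAlgClosed K] {n : ℕ}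
    {S : Set (Matrix (Fin n) (Fin n) K)} (hS : ∀ A ∈ S, ∀ B ∈ S, Commute A B) :
    ∃ T U : Matrix (Fin n) (Fin n) K, T * U = 1 ∧
      ∀ A ∈ S, (U * A * T).BlockTriangular id := by
  obtain ⟨b, hb⟩ := Module.End.exists_basis_forall_mem_span_Ici (K := K) (V := Fin n → K)
    (n := n) (by simp) (S := Matrix.toLin' '' S) (by
      rintro _ ⟨A, hA, rfl⟩ _ ⟨B, hB, rfl⟩
      exact (hS A hA B hB).map Matrix.toLinAlgEquiv')
  let c := b.reindex Fin.revPerm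
  let e := Pi.basisFun K (Fin n)
  refine ⟨e.toMatrix c, c.toMatrix e, Module.Basis.toMatrix_mul_toMatrix_flip _ _,
    fun A hA i j hij => ?_⟩
  have hA' : A = LinearMap.toMatrix e e A.toLin' := by
    simp [e, LinearMap.toMatrix_eq_toMatrix']
  rw [hA', basis_toMatrix_mul_linearMap_toMatrix_mul_basis_toMatrix, LinearMap.toMatrix_apply]
  have := b.mem_span_image.1 (hb _ ⟨A, hA, rfl⟩ j.rev)
  by_contra hne
  have h : i.rev ∈ Set.Ici j.rev := this (by simpa [c] using hne)
  simp at h hij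
  omega

/-- If the field of constants `K` is algebraically closed and `M` is
nonderogatory with `M M' = M' M`, then `M` is `K`-triangularizable. -/
theorem nonderogatory_K_triangularizable {F : Type*} [Field F]
    (d : F → F) (hd : IsDeriv d)
    (K : Subfield F) (hK : ∀ x, x ∈ K ↔ d x = 0) (hKalg : IsAlgClosed K)
    {n : ℕ} (M : Matrix (Fin n) (Fin n) F)
    (hnd : minpoly F M = M.charpoly)
    (hcomm : M * M.map d = M.map d * M) :
    ∃ T : Matrix (Fin n) (Fin n) F, IsUnit T ∧ (∀ p q, d (T p q) = 0) ∧
      (T⁻¹ * M * T).BlockTriangular id := by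
  set A := Algebra.adjoin F {M}
  have hM' : M.map d ∈ A := Matrix.mem_adjoin_of_minpoly_eq_charpoly hnd hcomm
  have hspan := hd.mem_span_constants (V := Subalgebra.toSubmodule A)
    (fun B hB => hd.map_mem_adjoin hM' hB) (Algebra.self_mem_adjoin_singleton F M)
  let ψ := K.subtype.mapMatrix (m := Fin n)
  have hψ : Function.Injective ψ := Matrix.map_injective K.subtype_injective
  obtain ⟨T, U, hTU, hT⟩ := Matrix.exists_blockTriangular_of_commute
    (S := {C : Matrix (Fin n) (Fin n) K | ψ C ∈ A}) (by
      intro B hB C hC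
      apply hψ
      rw [map_mul, map_mul]
      exact congrArg Subtype.val (mul_comm (⟨_, hB⟩ : A) ⟨_, hC⟩))
  have hTU' : ψ T * ψ U = 1 := by rw [← map_mul, hTU, map_one]
  refine ⟨ψ T, IsUnit.of_mul_eq_one _ hTU', fun p q => (hK _).1 (T p q).2, ?_⟩
  rw [Matrix.inv_eq_right_inv hTU']
  clear_value A
  clear hnd hcomm hM'
  induction hspan using Submodule.span_induction with
  | zero => simp [Matrix.blockTriangular_zero]
  | add x y _ _ hx hy =>
    rw [mul_add, add_mul]
    exact hx.add hy
  | smul a x _ hx =>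
    rw [mul_smul_comm, smul_mul_assoc]
    exact fun i j hij => by simp [hx hij]
  | mem C hC =>
    obtain ⟨hCA, hC'⟩ := hC
    let C₀ : Matrix (Fin n) (Fin n) K :=
      .of fun i j => ⟨C i j, (hK _).2 (congrFun (congrFun hC' i) j)⟩
    have hC₀ : ψ C₀ = C := rfl
    rw [← hC₀, ← map_mul, ← map_mul]
    exact (hT C₀ hCA).map K.subtype
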